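/- Let c : ℤ^d → ℂ be (C,a)-semi-analytic in coefficient form and let N be an integer with N ≥ 2 a d. Then sqrt( ∑_{k ∈ [-N..N]^d} | ∑_{p ∈ ℤ^d, p ≠ 0} c[ k + (2N+1) p ] |² + ∑_{k ∈ ℤ^d ∖ [-N..N]^d} |c[k]|² ) ≤ 2√2 · e³ · C · exp( -3N/(5a) ). -/

import Mathlib

/-- Euclidean norm of an integer vector `k ∈ ℤ^d`. -/
noncomputable def znorm {d : ℕ} (k : Fin d → ℤ) : ℝ :=
  Real.sqrt (∑ i, ((k i : ℝ)) ^ 2)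

/-- Cauchy–Schwarz for the norm of an infinite sum. -/
lemma norm_tsum_sq_le_tsum_mul_tsum {ι : Type*} {f : ι → ℂ} {u v : ι → ℝ}
    (hu : ∀ i, 0 ≤ u i) (hv : ∀ i, 0 ≤ v i) (hfuv : ∀ i, ‖f i‖ ^ 2 ≤ u i * v i)
    (hus : Summable u) (hvs : Summable v) :
    ‖∑' i, f i‖ ^ 2 ≤ (∑' i, u i) * ∑' i, v i := by
  have hU : 0 ≤ ∑' i, u i := tsum_nonneg hu
  have hV : 0 ≤ ∑' i, v i := tsum_nonneg hv
  have hfin (s : Finset ι) : ∑ i ∈ s, ‖f i‖ ≤ √((∑' i, u i) * ∑' i, v i) := by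
    apply Real.le_sqrt_of_sq_le
    calc (∑ i ∈ s, ‖f i‖) ^ 2 ≤ (∑ i ∈ s, u i) * ∑ i ∈ s, v i :=
          Finset.sum_sq_le_sum_mul_sum_of_sq_le_mul s (fun i _ ↦ hu i) (fun i _ ↦ hv i)
            fun i _ ↦ hfuv i
      _ ≤ _ := mul_le_mul (hus.sum_le_tsum s fun i _ ↦ hu i) (hvs.sum_le_tsum s fun i _ ↦ hv i)
          (Finset.sum_nonneg fun i _ ↦ hv i) hU
  have hsum : Summable fun i ↦ ‖f i‖ := summable_of_sum_le (fun i ↦ norm_nonneg _) hfin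
  have hle : ‖∑' i, f i‖ ≤ √((∑' i, u i) * ∑' i, v i) :=
    (norm_tsum_le_tsum_norm hsum).trans (hsum.tsum_le_of_sum_le hfin)
  calc ‖∑' i, f i‖ ^ 2 ≤ √((∑' i, u i) * ∑' i, v i) ^ 2 := by gcongr
    _ = _ := Real.sq_sqrt (mul_nonneg hU hV)

/-- The sum over a lattice of a product weight is at most the power of the one-dimensional sum. -/
lemma sum_prod_weight_le_pow {κ : Type*} {d : ℕ} {h : κ → ℝ} {K : ℝ} (hh : ∀ j, 0 ≤ h j)
    (hK : ∀ t : Finset κ, ∑ j ∈ t, h j ≤ K) (s : Finset (Fin d → κ)) :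
    ∑ p ∈ s, ∏ i, h (p i) ≤ K ^ d := by
  classical
  let t : Fin d → Finset κ := fun i ↦ s.image fun p ↦ p i
  have hst : s ⊆ Fintype.piFinset t := fun p hp ↦
    Fintype.mem_piFinset.2 fun i ↦ Finset.mem_image_of_mem (fun p ↦ p i) hp
  calc ∑ p ∈ s, ∏ i, h (p i) ≤ ∑ p ∈ Fintype.piFinset t, ∏ i, h (p i) :=
        Finset.sum_le_sum_of_subset_of_nonneg hst fun p _ _ ↦ Finset.prod_nonneg fun i _ ↦ hh _
    _ = ∏ i, ∑ j ∈ t i, h j := (Finset.prod_univ_sum t fun _ j ↦ h j).symm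
    _ ≤ ∏ _i : Fin d, K :=
        Finset.prod_le_prod (fun i _ ↦ Finset.sum_nonneg fun j _ ↦ hh j) fun i _ ↦ hK _
    _ = K ^ d := by simp

/-- A quartically decaying weight on `ℤ`, equal to `1` at the origin. -/
noncomputable def quarticWeight (j : ℤ) : ℝ := (max 1 ((j : ℝ) ^ 2) ^ 2)⁻¹

lemma quarticWeight_pos (j : ℤ) : 0 < quarticWeight j := by
  unfold quarticWeight
  positivity

lemma hasSum_quarticWeight : HasSum quarticWeight (1 + Real.pi ^ 4 / 45) := by
  have hz : HasSum (fun n : ℕ ↦ (1 : ℝ) / ((n + 1 : ℕ) : ℝ) ^ 4) (Real.pi ^ 4 / 90) := by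
    simpa using (hasSum_nat_add_iff' 1).2 hasSum_zeta_four
  have hval (n : ℕ) (j : ℤ) (hj : (j : ℝ) ^ 2 = ((n : ℝ) + 1) ^ 2) :
      (1 : ℝ) / ((n + 1 : ℕ) : ℝ) ^ 4 = quarticWeight j := by
    have h1 : (1 : ℝ) ≤ ((n : ℝ) + 1) ^ 2 := by nlinarith [(Nat.cast_nonneg n : (0 : ℝ) ≤ n)]
    rw [quarticWeight, hj, max_eq_right h1]
    push_cast
    rw [one_div]
    ring_nf
  have h₁ : HasSum (fun n : ℕ ↦ quarticWeight (n + 1)) (Real.pi ^ 4 / 90) :=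
    hz.congr_fun fun n ↦ (hval n _ (by push_cast; ring)).symm
  have h₂ : HasSum (fun n : ℕ ↦ quarticWeight (-(n + 1))) (Real.pi ^ 4 / 90) :=
    hz.congr_fun fun n ↦ (hval n _ (by push_cast; ring)).symm
  convert h₁.of_add_one_of_neg_add_one h₂ using 1
  have h0 : quarticWeight 0 = 1 := by simp [quarticWeight]
  rw [h0]
  ring

lemma sum_quarticWeight_le (t : Finset ℤ) : ∑ j ∈ t, quarticWeight j ≤ Real.exp (6 / 5) := by
  have hpi : Real.pi ^ 4 ≤ 3.15 ^ 4 := by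
    have := Real.pi_lt_d2
    have := Real.pi_pos
    gcongr
  have hexp : (3.3 : ℝ) ≤ Real.exp (6 / 5) := by
    have h1 := Real.exp_one_gt_d9
    have h2 : (1.22 : ℝ) ≤ Real.exp (1 / 5) := by
      have := Real.quadratic_le_exp_of_nonneg (show (0 : ℝ) ≤ 1 / 5 by norm_num)
      norm_num at this ⊢
      linarith
    rw [show (6 / 5 : ℝ) = 1 + 1 / 5 by norm_num, Real.exp_add]
    nlinarith
  calc ∑ j ∈ t, quarticWeight j ≤ 1 + Real.pi ^ 4 / 45 :=
        sum_le_hasSum t (fun j _ ↦ (quarticWeight_pos j).le) hasSum_quarticWeight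
    _ ≤ 3.3 := by norm_num at hpi ⊢; linarith
    _ ≤ _ := hexp

lemma znorm_sq {d : ℕ} (k : Fin d → ℤ) : znorm k ^ 2 = ∑ i, (k i : ℝ) ^ 2 :=
  Real.sq_sqrt (Finset.sum_nonneg fun _ _ ↦ sq_nonneg _)

/-- For a nonzero integer vector, large powers of the norm dominate the inverse product weight. -/
lemma inv_prod_quarticWeight_le {d m : ℕ} (hm : 2 * d ≤ m) {p : Fin d → ℤ} (hp : p ≠ 0) :
    (∏ i, quarticWeight (p i))⁻¹ ≤ (∑ i, (p i : ℝ) ^ 2) ^ m := by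
  have hcoord (i : Fin d) : (p i : ℝ) ^ 2 ≤ ∑ i, (p i : ℝ) ^ 2 :=
    Finset.single_le_sum (f := fun i ↦ (p i : ℝ) ^ 2) (fun _ _ ↦ sq_nonneg _) (Finset.mem_univ i)
  have hone : 1 ≤ ∑ i, (p i : ℝ) ^ 2 := by
    obtain ⟨i, hi⟩ := Function.ne_iff.1 hp
    refine le_trans ?_ (hcoord i)
    have : 0 < p i ^ 2 := pow_pos (abs_pos.2 hi) 2 |>.trans_eq (sq_abs _)
    exact_mod_cast this
  calc (∏ i, quarticWeight (p i))⁻¹ = ∏ i, max 1 ((p i : ℝ) ^ 2) ^ 2 := by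
        simp [quarticWeight]
    _ ≤ ∏ _i : Fin d, (∑ i, (p i : ℝ) ^ 2) ^ 2 := by
        gcongr with i
        exact max_le hone (hcoord i)
    _ = (∑ i, (p i : ℝ) ^ 2) ^ (2 * d) := by simp [pow_mul]
    _ ≤ _ := pow_le_pow_right₀ hone hm

/-- Shifting a box point by a multiple of the box width moves each coordinate far away. -/
lemma mul_sq_le_shift_sq {N : ℕ} {k p : ℤ} (hk : k ∈ Finset.Icc (-(N : ℤ)) N) :
    (N : ℤ) ^ 2 * p ^ 2 ≤ (k + (2 * (N : ℤ) + 1) * p) ^ 2 := by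
  obtain ⟨hk₁, hk₂⟩ := Finset.mem_Icc.1 hk
  have hN : (0 : ℤ) ≤ N := Int.natCast_nonneg N
  have key : 0 ≤ (k + (3 * (N : ℤ) + 1) * p) * (k + ((N : ℤ) + 1) * p) := by
    rcases lt_trichotomy p 0 with hp | rfl | hp
    · apply mul_nonneg_of_nonpos_of_nonpos <;> nlinarith
    · simpa using mul_self_nonneg k
    · apply mul_nonneg <;> nlinarith
  linarith

lemma shift_injective {d N : ℕ} {k l p q : Fin d → ℤ}
    (hk : ∀ i, k i ∈ Finset.Icc (-(N : ℤ)) N) (hl : ∀ i, l i ∈ Finset.Icc (-(N : ℤ)) N)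
    (h : (fun i ↦ k i + (2 * (N : ℤ) + 1) * p i) = fun i ↦ l i + (2 * (N : ℤ) + 1) * q i) :
    k = l ∧ p = q := by
  have key (i : Fin d) : p i = q i := by
    have hi := congrFun h i
    have h1 := Finset.mem_Icc.1 (hk i)
    have h2 := Finset.mem_Icc.1 (hl i)
    rcases lt_trichotomy (p i) (q i) with hlt | heq | hlt
    · nlinarith
    · exact heq
    · nlinarith
  refine ⟨funext fun i ↦ ?_, funext key⟩
  have hi := congrFun h i
  simp only [key i] at hi
  linarith

/-- Weighted moments of order `2 m` control the whole aliasing error. -/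
lemma aliasing_sq_le {d : ℕ} (c : (Fin d → ℤ) → ℂ) {N m : ℕ} (hN : 0 < N) (hm : 2 * d ≤ m)
    (hsum : Summable fun k : Fin d → ℤ ↦ znorm k ^ (2 * m) * ‖c k‖ ^ 2) :
    (∑ k ∈ Fintype.piFinset (fun _ : Fin d => Finset.Icc (-(N : ℤ)) N),
        ‖∑' p : {p : Fin d → ℤ // p ≠ 0},
            c (fun i => k i + (2 * (N : ℤ) + 1) * (p : Fin d → ℤ) i)‖ ^ 2) +
      ∑' k : {k : Fin d → ℤ // ¬ ∀ i, (k : Fin d → ℤ) i ∈ Finset.Icc (-(N : ℤ)) N},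
        ‖c (k : Fin d → ℤ)‖ ^ 2 ≤
      2 * Real.exp (6 / 5) ^ d *
        ((∑' k : Fin d → ℤ, znorm k ^ (2 * m) * ‖c k‖ ^ 2) / (N : ℝ) ^ (2 * m)) := by
  set F : (Fin d → ℤ) → ℝ := fun k ↦ znorm k ^ (2 * m) * ‖c k‖ ^ 2 with hF
  have hNR : (0 : ℝ) < N := by exact_mod_cast hN
  have hF0 (k) : 0 ≤ F k := by
    have : 0 ≤ znorm k := Real.sqrt_nonneg _
    positivity
  set B := Fintype.piFinset (fun _ : Fin d => Finset.Icc (-(N : ℤ)) N)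
  set K : ℝ := Real.exp (6 / 5) ^ d
  have hK1 : 1 ≤ K := one_le_pow₀ (Real.one_le_exp (by norm_num))
  let P := {p : Fin d → ℤ // p ≠ 0}
  let shift : B × P → Fin d → ℤ := fun x i ↦ x.1.1 i + (2 * (N : ℤ) + 1) * x.2.1 i
  have hshift : Function.Injective shift := by
    rintro ⟨⟨k, hk⟩, ⟨p, hp⟩⟩ ⟨⟨l, hl⟩, ⟨q, hq⟩⟩ h
    obtain ⟨rfl, rfl⟩ := shift_injective (Fintype.mem_piFinset.1 hk) (Fintype.mem_piFinset.1 hl) h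
    rfl
  have hFs : Summable fun x ↦ F (shift x) := hsum.comp_injective hshift
  have hwfin (s : Finset P) : ∑ p ∈ s, ∏ i, quarticWeight (p.1 i) ≤ K := by
    have := sum_prod_weight_le_pow (fun j ↦ (quarticWeight_pos j).le) sum_quarticWeight_le
      (s.map (Function.Embedding.subtype _))
    simpa using this
  have hw0 (p : P) : 0 ≤ ∏ i, quarticWeight (p.1 i) :=
    Finset.prod_nonneg fun i _ ↦ (quarticWeight_pos _).le
  have hws : Summable fun p : P ↦ ∏ i, quarticWeight (p.1 i) := summable_of_sum_le hw0 hwfin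
  have hwK : ∑' p : P, ∏ i, quarticWeight (p.1 i) ≤ K := hws.tsum_le_of_sum_le hwfin
  have hinner (k : B) : ‖∑' p : P, c (shift (k, p))‖ ^ 2 ≤
      K * ((∑' p : P, F (shift (k, p))) / (N : ℝ) ^ (2 * m)) := by
    have hv : Summable fun p : P ↦ F (shift (k, p)) / (N : ℝ) ^ (2 * m) :=
      (hFs.prod_factor k).div_const _
    have hv0 (p : P) : 0 ≤ F (shift (k, p)) / (N : ℝ) ^ (2 * m) :=
      div_nonneg (hF0 _) (by positivity)
    refine (norm_tsum_sq_le_tsum_mul_tsum hw0 hv0 (fun p ↦ ?_) hws hv).trans ?_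
    · have hpos : 0 < ∏ i, quarticWeight (p.1 i) :=
        Finset.prod_pos fun i _ ↦ quarticWeight_pos _
      have hlow : (N : ℝ) ^ (2 * m) * (∏ i, quarticWeight (p.1 i))⁻¹ ≤
          znorm (shift (k, p)) ^ (2 * m) := by
        calc (N : ℝ) ^ (2 * m) * (∏ i, quarticWeight (p.1 i))⁻¹
            ≤ (N : ℝ) ^ (2 * m) * (∑ i, (p.1 i : ℝ) ^ 2) ^ m := by
              gcongr
              exact inv_prod_quarticWeight_le hm p.2
          _ = (∑ i, (N : ℝ) ^ 2 * (p.1 i : ℝ) ^ 2) ^ m := by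
              rw [← Finset.mul_sum, mul_pow, pow_mul]
          _ ≤ (∑ i, (shift (k, p) i : ℝ) ^ 2) ^ m := by
              gcongr with i
              exact_mod_cast mul_sq_le_shift_sq (p := p.1 i) (Fintype.mem_piFinset.1 k.2 i)
          _ = _ := by rw [← znorm_sq, pow_mul]
      rw [mul_inv_le_iff₀ hpos] at hlow
      rw [hF, ← mul_div_assoc, le_div_iff₀ (by positivity)]
      nlinarith [mul_le_mul_of_nonneg_right hlow (sq_nonneg ‖c (shift (k, p))‖)]
    · rw [tsum_div_const]
      gcongr
      exact div_nonneg (tsum_nonneg fun p ↦ hF0 _) (by positivity)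
  have hbox : ∑ k ∈ B, ‖∑' p : P, c (fun i => k i + (2 * (N : ℤ) + 1) * p.1 i)‖ ^ 2 ≤
      K * ((∑' k, F k) / (N : ℝ) ^ (2 * m)) := by
    rw [← Finset.sum_coe_sort B]
    calc ∑ k : B, ‖∑' p : P, c (shift (k, p))‖ ^ 2
        ≤ ∑ k : B, K * ((∑' p : P, F (shift (k, p))) / (N : ℝ) ^ (2 * m)) :=
          Finset.sum_le_sum fun k _ ↦ hinner k
      _ = K * ((∑' x, F (shift x)) / (N : ℝ) ^ (2 * m)) := by
          rw [hFs.tsum_prod, tsum_fintype, Finset.sum_div, Finset.mul_sum]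
      _ ≤ _ := by
          gcongr
          exact tsum_comp_le_tsum_of_inj hsum hF0 hshift
  have htail : ∑' k : {k : Fin d → ℤ // ¬ ∀ i, k i ∈ Finset.Icc (-(N : ℤ)) N}, ‖c k.1‖ ^ 2 ≤
      (∑' k, F k) / (N : ℝ) ^ (2 * m) := by
    have hle (k : {k : Fin d → ℤ // ¬ ∀ i, k i ∈ Finset.Icc (-(N : ℤ)) N}) :
        ‖c k.1‖ ^ 2 ≤ F k.1 / (N : ℝ) ^ (2 * m) := by
      obtain ⟨i, hi⟩ := not_forall.1 k.2
      have hNk : (N : ℝ) ^ 2 ≤ znorm k.1 ^ 2 := by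
        rw [znorm_sq]
        refine le_trans ?_ (Finset.single_le_sum (f := fun i ↦ (k.1 i : ℝ) ^ 2)
          (fun _ _ ↦ sq_nonneg _) (Finset.mem_univ i))
        have : (N : ℤ) ^ 2 ≤ k.1 i ^ 2 := by
          rw [Finset.mem_Icc, not_and_or] at hi
          rcases hi with hi | hi <;> nlinarith
        exact_mod_cast this
      rw [le_div_iff₀ (by positivity), mul_comm]
      simp only [hF, pow_mul]
      gcongr
    have hs := (hsum.comp_injective
      (Subtype.val_injective (p := fun k : Fin d → ℤ ↦
        ¬ ∀ i, k i ∈ Finset.Icc (-(N : ℤ)) N))).div_const ((N : ℝ) ^ (2 * m))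
    calc _ ≤ ∑' k : {k : Fin d → ℤ // ¬ ∀ i, k i ∈ Finset.Icc (-(N : ℤ)) N},
          F k.1 / (N : ℝ) ^ (2 * m) :=
          (hs.of_nonneg_of_le (fun _ ↦ sq_nonneg _) hle).tsum_le_tsum hle hs
      _ ≤ _ := by
          rw [tsum_div_const]
          gcongr
          exact tsum_comp_le_tsum_of_inj hsum hF0 Subtype.val_injective
  have hT : 0 ≤ (∑' k, F k) / (N : ℝ) ^ (2 * m) := div_nonneg (tsum_nonneg hF0) (by positivity)
  nlinarith [mul_le_mul_of_nonneg_right hK1 hT]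

/-- Elementary upper Stirling bound. -/
lemma factorial_le_exp_mul_pow {m : ℕ} (hm : 0 < m) :
    (m.factorial : ℝ) ≤ Real.exp 1 * m * (m / Real.exp 1) ^ m := by
  obtain ⟨n, rfl⟩ := Nat.exists_eq_succ_of_ne_zero hm.ne'
  have h := Stirling.stirlingSeq'_antitone (Nat.zero_le n)
  simp only [Function.comp, Nat.succ_eq_add_one, zero_add, Stirling.stirlingSeq_one] at h
  rw [Stirling.stirlingSeq, div_le_iff₀ (by positivity)] at h
  refine h.trans ?_
  rw [Real.sqrt_mul (by norm_num)]
  have hs : √((n + 1 : ℕ) : ℝ) ≤ ((n + 1 : ℕ) : ℝ) := by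
    rw [Real.sqrt_le_left (by positivity)]
    have : (1 : ℝ) ≤ ((n + 1 : ℕ) : ℝ) := by simp
    nlinarith
  calc _ = Real.exp 1 * √((n + 1 : ℕ) : ℝ) * (((n + 1 : ℕ) : ℝ) / Real.exp 1) ^ (n + 1) := by
        field_simp
    _ ≤ _ := by gcongr

lemma factorial_floor_le {x : ℝ} (hx : 1 ≤ x) :
    ((⌊x⌋₊).factorial : ℝ) ≤ 10 * Real.exp (1 - 9 / 10 * x) * x ^ ⌊x⌋₊ := by
  have hx0 : 0 ≤ x := by linarith
  have hmpos : 0 < ⌊x⌋₊ := Nat.floor_pos.2 hx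
  have hmx : (⌊x⌋₊ : ℝ) ≤ x := Nat.floor_le hx0
  have hxm : x < ⌊x⌋₊ + 1 := Nat.lt_floor_add_one x
  have hx10 : x ≤ 10 * Real.exp (x / 10 - 1) := by
    have := Real.add_one_le_exp (x / 10 - 1)
    linarith
  calc ((⌊x⌋₊).factorial : ℝ)
      ≤ Real.exp 1 * ⌊x⌋₊ * (⌊x⌋₊ / Real.exp 1) ^ ⌊x⌋₊ := factorial_le_exp_mul_pow hmpos
    _ = Real.exp 1 * ⌊x⌋₊ * Real.exp (-⌊x⌋₊) * (⌊x⌋₊ : ℝ) ^ ⌊x⌋₊ := by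
        rw [div_pow, ← Real.exp_nat_mul, mul_one, Real.exp_neg]
        ring
    _ ≤ Real.exp 1 * (10 * Real.exp (x / 10 - 1)) * Real.exp (1 - x) * x ^ ⌊x⌋₊ := by
        gcongr
        · exact hmx.trans hx10
        · linarith
    _ = _ := by
        rw [show 1 - 9 / 10 * x = 1 + (x / 10 - 1) + (1 - x) by ring, Real.exp_add, Real.exp_add]
        ring

/-- If `c : ℤ^d → ℂ` is `(C,a)`-semi-analytic in coefficient form and
`N ≥ 2ad`, then the ℓ²-aliasing error satisfies
`sqrt( ∑_{k ∈ [-N..N]^d} |∑_{p ≠ 0} c[k+(2N+1)p]|² + ∑_{k ∉ [-N..N]^d} |c[k]|² )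
  ≤ 2√2 e³ C exp(-3N/(5a))`. -/
theorem dft_aliasing_error_bound {d : ℕ} (c : (Fin d → ℤ) → ℂ) (C a : ℝ)
    (hC : 0 < C) (ha : 0 < a)
    (hsummable : ∀ m : ℕ, Summable fun k : Fin d → ℤ => znorm k ^ (2 * m) * ‖c k‖ ^ 2)
    (hsa : ∀ m : ℕ,
      Real.sqrt (∑' k : Fin d → ℤ, znorm k ^ (2 * m) * ‖c k‖ ^ 2)
        ≤ C * a ^ m * Nat.factorial m)
    (N : ℕ) (hN : 2 * a * d ≤ (N : ℝ)) :
    Real.sqrt (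
      (∑ k ∈ Fintype.piFinset (fun _ : Fin d => Finset.Icc (-(N : ℤ)) N),
        ‖∑' p : {p : Fin d → ℤ // p ≠ 0},
            c (fun i => k i + (2 * (N : ℤ) + 1) * (p : Fin d → ℤ) i)‖ ^ 2) +
      ∑' k : {k : Fin d → ℤ // ¬ ∀ i, (k : Fin d → ℤ) i ∈ Finset.Icc (-(N : ℤ)) N},
        ‖c (k : Fin d → ℤ)‖ ^ 2)
      ≤ 2 * Real.sqrt 2 * Real.exp 3 * C * Real.exp (-(3 * (N : ℝ)) / (5 * a)) := by
  rcases Nat.eq_zero_or_pos d with rfl | hd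
  · have h1 : IsEmpty {p : Fin 0 → ℤ // p ≠ 0} := ⟨fun p ↦ p.2 (Subsingleton.elim _ _)⟩
    have h2 : IsEmpty {k : Fin 0 → ℤ // ¬ ∀ i, k i ∈ Finset.Icc (-(N : ℤ)) N} :=
      ⟨fun k ↦ k.2 fun i ↦ i.elim0⟩
    simp only [tsum_empty, norm_zero, ne_eq, OfNat.ofNat_ne_zero, not_false_eq_true, zero_pow,
      Finset.sum_const_zero, add_zero, Real.sqrt_zero]
    positivity
  have hdR : (1 : ℝ) ≤ d := by exact_mod_cast hd
  have hNR : (0 : ℝ) < N := lt_of_lt_of_le (by positivity) hN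
  have hNpos : 0 < N := by exact_mod_cast hNR
  set x : ℝ := N / a with hx
  have hNx : (N : ℝ) = a * x := by rw [hx]; field_simp
  have hdx : 2 * (d : ℝ) ≤ x := by
    rw [hx, le_div_iff₀ ha]
    linarith
  have hx0 : 0 < x := by linarith
  set m := ⌊x⌋₊
  have hdm : 2 * d ≤ m := Nat.le_floor (by push_cast; exact hdx)
  have hfact : (m.factorial : ℝ) ≤ 10 * Real.exp (1 - 9 / 10 * x) * x ^ m :=
    factorial_floor_le (by linarith)
  have hmoment : (∑' k : Fin d → ℤ, znorm k ^ (2 * m) * ‖c k‖ ^ 2) / (N : ℝ) ^ (2 * m) ≤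
      (C * (10 * Real.exp (1 - 9 / 10 * x))) ^ 2 := by
    rw [div_le_iff₀ (by positivity), mul_comm 2 m, pow_mul (N : ℝ), ← mul_pow, mul_comm m 2]
    refine (Real.sqrt_le_left (by positivity)).1 ((hsa m).trans ?_)
    calc C * a ^ m * m.factorial ≤ C * a ^ m * (10 * Real.exp (1 - 9 / 10 * x) * x ^ m) := by
          gcongr
      _ = _ := by rw [hNx, mul_pow]; ring
  have hK : Real.exp (6 / 5) ^ d ≤ Real.exp (3 / 5 * x) := by
    rw [← Real.exp_nat_mul]
    exact Real.exp_le_exp.2 (by linarith)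
  have hexp : (25 : ℝ) ≤ Real.exp 4 := by
    have h1 : (2.7 : ℝ) ≤ Real.exp 1 := by linarith [Real.exp_one_gt_d9]
    calc (25 : ℝ) ≤ 2.7 ^ 4 := by norm_num
      _ ≤ Real.exp 1 ^ 4 := by gcongr
      _ = Real.exp 4 := by rw [← Real.exp_nat_mul]; norm_num
  rw [Real.sqrt_le_left (by positivity)]
  calc _ ≤ _ := aliasing_sq_le c hNpos hdm (hsummable m)
    _ ≤ 2 * Real.exp (3 / 5 * x) * (C * (10 * Real.exp (1 - 9 / 10 * x))) ^ 2 := by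
        refine mul_le_mul (by gcongr) hmoment (div_nonneg (tsum_nonneg fun k ↦ ?_) ?_) ?_
        · have : 0 ≤ znorm k := Real.sqrt_nonneg _
          positivity
        all_goals positivity
    _ = 8 * C ^ 2 * 25 * Real.exp (2 - 6 / 5 * x) := by
        rw [show 2 - 6 / 5 * x = 3 / 5 * x + (1 - 9 / 10 * x) + (1 - 9 / 10 * x) by ring,
          Real.exp_add, Real.exp_add]
        ring
    _ ≤ 8 * C ^ 2 * Real.exp 4 * Real.exp (2 - 6 / 5 * x) := by gcongr
    _ = (2 * √2 * Real.exp 3 * C * Real.exp (-(3 * (N : ℝ)) / (5 * a))) ^ 2 := by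
        have hNa : -(3 * (N : ℝ)) / (5 * a) = -(3 / 5 * x) := by rw [hx]; field_simp
        rw [hNa, mul_pow, mul_pow, mul_pow, mul_pow, Real.sq_sqrt (by norm_num), mul_assoc,
          ← Real.exp_add, ← Real.exp_nat_mul, ← Real.exp_nat_mul,
          show 4 + (2 - 6 / 5 * x) = ((2 : ℕ) : ℝ) * 3 + ((2 : ℕ) : ℝ) * -(3 / 5 * x) by
            push_cast; ring, Real.exp_add]
        ring
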